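/- Fix a real number p ≥ 2 and an integer n ≥ 1, and let φ_n be as defined in the context. Then the derivative of φ_n satisfies |φ_n'(r)| ≤ p·|r|^{p-1} for every r ∈ ℝ. -/

import Mathlib

/-- The truncated power function `φ_n`: `φ_n(r) = |r|^p` for `|r| < n`, and the second-order
Taylor extension `n^{p-2} (p(p-1)/2)(|r|-n)² + p n^{p-1}(|r|-n) + n^p` for `|r| ≥ n`. -/
noncomputable def phi (p : ℝ) (n : ℕ) (r : ℝ) : ℝ :=
  if |r| < n then |r| ^ p
  else (n : ℝ) ^ (p - 2) * (p * (p - 1) / 2) * (|r| - n) ^ 2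
      + p * (n : ℝ) ^ (p - 1) * (|r| - n) + (n : ℝ) ^ p

/-- On `[-n, n]`, the truncated power is the power `|x|^p`. -/
lemma phi_eq_abs_rpow {p : ℝ} {n : ℕ} {x : ℝ} (hx : |x| ≤ n) : phi p n x = |x| ^ p := by
  rcases hx.lt_or_eq with h | h
  · simp [phi, h]
  · simp [phi, h]

/-- Off `[-n, n]`, the derivative of the truncated power is the derivative of its Taylor
extension. -/
lemma hasDerivAt_phi_of_lt {p : ℝ} {n : ℕ} {r : ℝ} (hr : (n : ℝ) < |r|) :
    HasDerivAt (phi p n)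
      ((p * (n : ℝ) ^ (p - 1) + (n : ℝ) ^ (p - 2) * (p * (p - 1)) * (|r| - n))
        * SignType.sign r) r := by
  have hr0 : r ≠ 0 := abs_pos.1 (n.cast_nonneg.trans_lt hr)
  have habs : HasDerivAt (fun x : ℝ => |x| - n) (SignType.sign r : ℝ) r :=
    (hasDerivAt_abs hr0).sub_const _
  have h := (((habs.pow 2).const_mul ((n : ℝ) ^ (p - 2) * (p * (p - 1) / 2))).add
    (habs.const_mul (p * (n : ℝ) ^ (p - 1)))).add_const ((n : ℝ) ^ p)
  refine (h.congr_of_eventuallyEq ?_).congr_deriv (by push_cast; ring)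
  filter_upwards [continuous_abs.continuousAt.eventually (lt_mem_nhds hr)] with x hx
  simp [phi, hx.not_gt]

/-- The graph of `x ^ q`, `q ≥ 1`, lies above its tangent line at `a > 0`. -/
lemma rpow_tangent_le {q a x : ℝ} (hq : 1 ≤ q) (ha : 0 < a) (hx : 0 ≤ x) :
    a ^ q + q * a ^ (q - 1) * (x - a) ≤ x ^ q := by
  have hb := one_add_mul_self_le_rpow_one_add (s := x / a - 1)
    (by linarith [div_nonneg hx ha.le]) hq
  rw [add_sub_cancel, Real.div_rpow hx ha.le, le_div_iff₀ (Real.rpow_pos_of_pos ha q)] at hb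
  rw [Real.rpow_sub_one ha.ne']
  refine le_of_eq_of_le ?_ hb
  field_simp

/-- For `p ≥ 2` and `n ≥ 1`, `|φ_n'(r)| ≤ p |r|^{p-1}` for every `r ∈ ℝ`. -/
theorem statement6 (p : ℝ) (hp : 2 ≤ p) (n : ℕ) (hn : 1 ≤ n) (r : ℝ) :
    |deriv (phi p n) r| ≤ p * |r| ^ (p - 1) := by
  have hn0 : (0 : ℝ) < n := by exact_mod_cast hn
  rcases le_or_gt |r| n with hr | hr
  · by_cases hd : DifferentiableAt ℝ (phi p n) r
    · have hmem : r ∈ Set.Icc (-(n : ℝ)) n := abs_le.1 hr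
      have hu : UniqueDiffWithinAt ℝ (Set.Icc (-(n : ℝ)) n) r :=
        uniqueDiffOn_Icc (by linarith) r hmem
      have h := (hasDerivAt_abs_rpow r (by linarith : 1 < p)).hasDerivWithinAt.congr
        (fun x hx => phi_eq_abs_rpow (abs_le.2 hx)) (phi_eq_abs_rpow hr)
      rw [hu.eq_deriv _ hd.hasDerivAt.hasDerivWithinAt h, abs_mul, abs_mul,
        abs_of_nonneg (by linarith : 0 ≤ p), abs_of_nonneg (by positivity : 0 ≤ |r| ^ (p - 2)),
        mul_assoc, ← Real.rpow_add_one' (abs_nonneg r) (by linarith)]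
      exact le_of_eq (by ring_nf)
    · rw [deriv_zero_of_not_differentiableAt hd, abs_zero]
      positivity
  · rw [(hasDerivAt_phi_of_lt hr).deriv, abs_mul]
    have hs : |(SignType.sign r : ℝ)| ≤ 1 := by
      cases SignType.sign r <;> simp
    have hp1 : 0 ≤ p - 1 := by linarith
    have hrn : 0 ≤ |r| - n := by linarith
    have ht := rpow_tangent_le (by linarith : 1 ≤ p - 1) hn0 (abs_nonneg r)
    rw [show p - 1 - 1 = p - 2 by ring] at ht
    refine (mul_le_of_le_one_right (abs_nonneg _) hs).trans ?_
    rw [abs_of_nonneg (by positivity)]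
    refine le_of_eq_of_le ?_ (mul_le_mul_of_nonneg_left ht (by linarith : 0 ≤ p))
    ring
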